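/- arXiv:1609.09149 — 10 statements merged into one kernel-verified Lean document; each statement's English description precedes it below -/
import Mathlib

section
/- Let S be a semiring in which every nonzero element has a multiplicative inverse (a semifield, i.e., a division semiring, not assumed commutative). Then S is left exact if and only if either S is a division ring (every element of S has an additive inverse) or 1 + 1 = 1 holds in S. -/
open Matrix

/-- A semiring `S` is left exact if every `S`-linear function on a finitely generated
submodule of a finite free left `S`-module extends to the whole module. -/
def IsLeftExact (S : Type*) [Semiring S] : Prop :=
  ∀ (n : ℕ) (L : Submodule S (Fin n → S)), L.FG →
    ∀ φ : L →ₗ[S] S, ∃ ψ : (Fin n → S) →ₗ[S] S, ∀ (x : Fin n → S) (hx : x ∈ L), ψ x = φ ⟨x, hx⟩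

theorem isLeftExact_of_divisionRing (S : Type*) [DivisionRing S] : IsLeftExact S := by
  intro n L _ φ
  obtain ⟨g, hg⟩ := LinearMap.exists_extend φ
  refine ⟨g, fun x hx => ?_⟩
  have := LinearMap.congr_fun hg ⟨x, hx⟩
  simpa using this

theorem isLeftExact_of_neg (S : Type*) [inst : DivisionSemiring S]
    (h : ∀ x : S, ∃ y : S, x + y = 0) : IsLeftExact S := by
  choose ng hng using h
  let R : DivisionRing S :=
    { inst with
      neg := ng
      zsmul := @zsmulRec S ⟨0⟩ ⟨(· + ·)⟩ ⟨ng⟩ (fun n x => n • x)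
      zsmul_zero' := fun a => zero_nsmul a
      zsmul_succ' := fun n a => succ_nsmul a n
      zsmul_neg' := fun n a => rfl
      neg_add_cancel := fun a => by
        rw [add_comm]; exact hng a
      qsmul := _
      qsmul_def := fun _ _ => rfl }
  exact @isLeftExact_of_divisionRing S R

section Idem
variable {S : Type*} [DivisionSemiring S]

/-- The canonical preorder of an idempotent semiring. -/
def ile (a b : S) : Prop := a + b = b

theorem ile_trans {a b c : S} (h : ile a b) (h' : ile b c) : ile a c := by
  unfold ile at *
  rw [← h', ← add_assoc, h]

theorem ile_mul_left {a b : S} (c : S) (h : ile a b) : ile (c * a) (c * b) := by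
  unfold ile at *
  rw [← mul_add, h]

theorem ile_mul_right {a b : S} (c : S) (h : ile a b) : ile (a * c) (b * c) := by
  unfold ile at *
  rw [← add_mul, h]

theorem ile_add {a b c d : S} (h : ile a b) (h' : ile c d) : ile (a + c) (b + d) := by
  unfold ile at *
  rw [add_add_add_comm, h, h']

theorem idem (h2 : (1 + 1 : S) = 1) (a : S) : a + a = a := by
  have := congrArg (a * ·) h2
  simpa [mul_add] using this

theorem ile_refl (h2 : (1 + 1 : S) = 1) (a : S) : ile a a := idem h2 a

theorem ile_zero (a : S) : ile 0 a := zero_add a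

theorem ile_add_left (h2 : (1 + 1 : S) = 1) (a b : S) : ile a (a + b) := by
  unfold ile
  rw [← add_assoc, idem h2]

theorem ile_antisymm {a b : S} (h : ile a b) (h' : ile b a) : a = b := by
  unfold ile at *
  rw [← h', add_comm, h]

theorem ile_inv {a b : S} (ha : a ≠ 0) (hb : b ≠ 0) (h : ile a b) : ile b⁻¹ a⁻¹ := by
  have h1 := ile_mul_right a⁻¹ (ile_mul_left b⁻¹ h)
  rwa [mul_assoc, mul_inv_cancel₀ ha, mul_one, inv_mul_cancel₀ hb, one_mul] at h1

theorem add_ne (h2 : (1 + 1 : S) = 1) {a : S} (b : S) (ha : a ≠ 0) : a + b ≠ 0 := by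
  intro h
  have := ile_add_left h2 a b
  unfold ile at this
  rw [h, add_zero] at this
  exact ha this

theorem binary_inf (h2 : (1 + 1 : S) = 1) (a b : S) :
    ∃ m, ile m a ∧ ile m b ∧ ∀ e c, ile c (e + a) → ile c (e + b) → ile c (e + m) := by
  by_cases ha : a = 0
  · subst ha
    exact ⟨0, ile_zero _, ile_zero _, fun e c h _ => h⟩
  by_cases hb : b = 0
  · subst hb
    exact ⟨0, ile_zero _, ile_zero _, fun e c _ h => h⟩
  have hs : a⁻¹ + b⁻¹ ≠ 0 := add_ne h2 _ (inv_ne_zero ha)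
  obtain ⟨m, hm⟩ : ∃ m, m = (a⁻¹ + b⁻¹)⁻¹ := ⟨_, rfl⟩
  have hm0 : m ≠ 0 := hm ▸ inv_ne_zero hs
  have hma : ile m a := by
    have := ile_inv (inv_ne_zero ha) hs (ile_add_left h2 a⁻¹ b⁻¹)
    rwa [inv_inv, ← hm] at this
  have hmb : ile m b := by
    have := ile_inv (inv_ne_zero hb) hs (by rw [add_comm]; exact ile_add_left h2 b⁻¹ a⁻¹)
    rwa [inv_inv, ← hm] at this
  have glb : ∀ x, ile x a → ile x b → ile x m := by
    intro x hxa hxb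
    by_cases hx : x = 0
    · rw [hx]; exact ile_zero _
    have h1 := ile_add (ile_inv hx ha hxa) (ile_inv hx hb hxb)
    rw [idem h2] at h1
    have := ile_inv hs (inv_ne_zero hx) h1
    rwa [inv_inv, ← hm] at this
  refine ⟨m, hma, hmb, fun e c hca hcb => ?_⟩
  have ht : e + m ≠ 0 := by rw [add_comm]; exact add_ne h2 _ hm0
  have key : ∀ a, ile m a → ile c (e + a) → ile (c * (e + m)⁻¹ * m) a := by
    intro a hma hca
    have hp : ile 1 (a * m⁻¹) := by
      have := ile_mul_right m⁻¹ hma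
      rwa [mul_inv_cancel₀ hm0] at this
    have h3 : ile (e + a) (a * m⁻¹ * (e + m)) := by
      rw [mul_add, mul_assoc a m⁻¹ m, inv_mul_cancel₀ hm0, mul_one]
      refine ile_add ?_ (ile_refl h2 a)
      simpa using ile_mul_right e hp
    have h4 := ile_mul_right m (ile_mul_right (e + m)⁻¹ (ile_trans hca h3))
    rwa [mul_assoc (a * m⁻¹), mul_inv_cancel₀ ht, mul_one, mul_assoc a, inv_mul_cancel₀ hm0,
      mul_one] at h4
  have h5 := ile_mul_right (e + m) (ile_mul_right m⁻¹ (glb _ (key a hma hca) (key b hmb hcb)))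
  rwa [mul_assoc (c * (e + m)⁻¹), mul_inv_cancel₀ hm0, mul_one, mul_assoc c, inv_mul_cancel₀ ht,
    mul_one, one_mul] at h5

theorem finset_inf (h2 : (1 + 1 : S) = 1) {ι : Type*} (K : Finset ι) (hK : K.Nonempty)
    (a : ι → S) :
    ∃ m, (∀ k ∈ K, ile m (a k)) ∧ ∀ e c, (∀ k ∈ K, ile c (e + a k)) → ile c (e + m) := by
  induction hK using Finset.Nonempty.cons_induction with
  | singleton k =>
    exact ⟨a k, by simp [ile_refl h2], fun e c h => h k (by simp)⟩
  | cons k K hk hK ih =>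
    obtain ⟨m, hm1, hm2⟩ := ih
    obtain ⟨m', h1, h3, h4⟩ := binary_inf h2 (a k) m
    refine ⟨m', ?_, fun e c h => h4 e c (h k (by simp)) (hm2 e c fun j hj => h j (by simp [hj]))⟩
    intro j hj
    rcases Finset.mem_cons.1 hj with rfl | hj
    · exact h1
    · exact ile_trans h3 (hm1 j hj)

theorem isLeftExact_of_idem (h2 : (1 + 1 : S) = 1) : IsLeftExact S := by
  classical
  intro n L hL φ
  obtain ⟨G, rfl⟩ := hL
  have hG : ∀ g ∈ G, g ∈ Submodule.span S (G : Set (Fin n → S)) :=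
    fun g hg => Submodule.subset_span hg
  -- a total version of φ
  let F : (Fin n → S) → S := fun x => if hx : x ∈ Submodule.span S (G : Set (Fin n → S)) then
    φ ⟨x, hx⟩ else 0
  have hF : ∀ x hx, F x = φ ⟨x, hx⟩ := fun x hx => dif_pos hx
  have Fadd : ∀ x y, x ∈ Submodule.span S (G : Set (Fin n → S)) →
      y ∈ Submodule.span S (G : Set (Fin n → S)) → F (x + y) = F x + F y := by
    intro x y hx hy
    rw [hF x hx, hF y hy, hF _ (Submodule.add_mem _ hx hy), ← map_add]
    rfl
  have Fsmul : ∀ (c : S) x, x ∈ Submodule.span S (G : Set (Fin n → S)) →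
      F (c • x) = c * F x := by
    intro c x hx
    rw [hF x hx, hF _ (Submodule.smul_mem _ c hx), ← smul_eq_mul, ← map_smul]
    rfl
  have F0 : F 0 = 0 := by simpa using Fsmul 0 0 (Submodule.zero_mem _)
  have hu : ∀ j, ∃ u : S, (∀ g ∈ G, ile (g j * u) (F g)) ∧
      ∀ e c s, s ≠ 0 → (∃ g ∈ G, g j ≠ 0) →
        (∀ g ∈ G, g j ≠ 0 → ile c (e + s * ((g j)⁻¹ * F g))) → ile c (e + s * u) := by
    intro j
    by_cases hj : (G.filter fun g => g j ≠ 0).Nonempty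
    · obtain ⟨m, hm1, hm2⟩ := finset_inf h2 _ hj fun g => (g j)⁻¹ * F g
      refine ⟨m, ?_, ?_⟩
      · intro g hg
        by_cases h0 : g j = 0
        · rw [h0, zero_mul]; exact ile_zero _
        have := ile_mul_left (g j) (hm1 g (by simp [hg, h0]))
        rwa [mul_inv_cancel_left₀ h0] at this
      · intro e c s hs _ h
        have := hm2 (s⁻¹ * e) (s⁻¹ * c) (by
          intro g hg
          rw [Finset.mem_filter] at hg
          have := ile_mul_left s⁻¹ (h g hg.1 hg.2)
          rwa [mul_add, inv_mul_cancel_left₀ hs] at this)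
        have := ile_mul_left s this
        rwa [mul_add, mul_inv_cancel_left₀ hs, mul_inv_cancel_left₀ hs] at this
    · refine ⟨0, fun g _ => by rw [mul_zero]; exact ile_zero _, ?_⟩
      rintro e c s hs ⟨g, hg, hgj⟩
      exact absurd ⟨g, by simp [hg, hgj]⟩ hj
  choose u hu1 hu2 using hu
  have sum_le : ∀ (J : Finset (Fin n)) (f : Fin n → S) (c : S), (∀ j ∈ J, ile (f j) c) →
      ile (∑ j ∈ J, f j) c := by
    intro J f c h
    induction J using Finset.induction_on with
    | empty => exact ile_zero _
    | insert j J hj ih =>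
      rw [Finset.sum_insert hj]
      have := ile_add (h j (by simp)) (ih fun k hk => h k (by simp [hk]))
      rwa [idem h2] at this
  have main : ∀ x ∈ G, ∀ (J : Finset (Fin n)) (y : Fin n → S),
      y ∈ Submodule.span S (G : Set (Fin n → S)) → (∀ j ∉ J, ile (x j) (y j)) →
      ile (F x) (F y + ∑ j ∈ J, x j * u j) := by
    intro x hx J
    induction J using Finset.induction_on with
    | empty =>
      intro y hy h
      have hxy : x + y = y := funext fun j => h j (by simp)
      have := Fadd x y (hG x hx) hy
      rw [hxy] at this
      rw [Finset.sum_empty, add_zero]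
      exact this.symm
    | insert j J hj ih =>
      intro y hy h
      rw [Finset.sum_insert hj]
      by_cases h0 : x j = 0
      · rw [h0, zero_mul, zero_add]
        refine ih y hy fun k hk => ?_
        by_cases hkj : k = j
        · rw [hkj, h0]; exact ile_zero _
        · exact h k (by simp [hk, hkj])
      · rw [add_comm (x j * u j), ← add_assoc]
        refine hu2 j _ _ _ h0 ⟨x, hx, h0⟩ fun g hg hgj => ?_
        have := ih (y + (x j * (g j)⁻¹) • g)
          (Submodule.add_mem _ hy (Submodule.smul_mem _ _ (hG g hg))) (by
            intro k hk
            by_cases hkj : k = j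
            · subst hkj
              rw [Pi.add_apply, Pi.smul_apply, smul_eq_mul, inv_mul_cancel_right₀ hgj, add_comm]
              exact ile_add_left h2 _ _
            · rw [Pi.add_apply]
              exact ile_trans (h k (by simp [hk, hkj])) (ile_add_left h2 _ _))
        rw [Fadd _ _ hy (Submodule.smul_mem _ _ (hG g hg)), Fsmul _ _ (hG g hg),
          mul_assoc, add_right_comm] at this
        exact this
  have hgen : ∀ g ∈ G, ∑ j, g j * u j = F g := by
    intro g hg
    refine ile_antisymm (sum_le _ _ _ fun j _ => hu1 j g hg) ?_
    have := main g hg Finset.univ 0 (Submodule.zero_mem _) (by simp)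
    rwa [F0, zero_add] at this
  let ψ : (Fin n → S) →ₗ[S] S :=
    { toFun := fun x => ∑ j, x j * u j
      map_add' := fun x y => by simp [add_mul, Finset.sum_add_distrib]
      map_smul' := fun c x => by simp [Finset.mul_sum, mul_assoc] }
  refine ⟨ψ, fun x hx => ?_⟩
  rw [← hF x hx]
  induction hx using Submodule.span_induction with
  | mem g hg => exact hgen g hg
  | zero => rw [map_zero, F0]
  | add x y hx hy ihx ihy => rw [map_add, Fadd x y hx hy, ihx, ihy]
  | smul c x hx ih => rw [map_smul, Fsmul c x hx, ih, smul_eq_mul]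

end Idem

theorem of_isLeftExact {S : Type*} [DivisionSemiring S] (hS : IsLeftExact S) :
    (∀ x : S, ∃ y : S, x + y = 0) ∨ (1 + 1 : S) = 1 := by
  by_cases hinv : ∃ y : S, 1 + y = 0
  · obtain ⟨y, hy⟩ := hinv
    exact Or.inl fun x => ⟨x * y, by simpa [mul_add] using congrArg (x * ·) hy⟩
  right
  have two : (1 + 1 : S) ≠ 0 := fun h => hinv ⟨1, h⟩
  have cancel2 : ∀ a b : S, a + a = b + b → a = b := by
    intro a b h
    have h' : a * (1 + 1) = b * (1 + 1) := by simpa [mul_add] using h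
    exact mul_right_cancel₀ two h'
  have wd : ∀ p q p' q' : S, p + (q + q) = p' + (q' + q') → (p + p) + q = (p' + p') + q' →
      p + p + 7 • q = p' + p' + 7 • q' := by
    intro p q p' q' h1 h3
    have e1 : (p + p + 7 • q) + (p + p + q) = (p' + p' + 7 • q') + (p + p + q) := by
      calc (p + p + 7 • q) + (p + p + q) = 4 • (p + (q + q)) := by abel
        _ = 4 • (p' + (q' + q')) := by rw [h1]
        _ = (p' + p' + 7 • q') + (p' + p' + q') := by abel
        _ = _ := by rw [h3]
    have e2 : p + p + 7 • q = (p + p + q) + 6 • q := by abel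
    have e3 : p' + p' + 7 • q' = (p + p + q) + 6 • q' := by rw [h3]; abel
    generalize p + p + 7 • q = a at *
    generalize p' + p' + 7 • q' = b at *
    generalize p + p + q = c at *
    apply cancel2
    have f1 : a + a = b + a := by
      conv_lhs => rw [show a + a = a + (c + 6 • q) by rw [← e2], ← add_assoc, e1, add_assoc, ← e2]
    have f2 : b + b = a + b := by
      conv_lhs => rw [show b + b = b + (c + 6 • q') by rw [← e3], ← add_assoc, ← e1, add_assoc, ← e3]
    rw [f1, f2, add_comm]
  let x1 : Fin 2 → S := ![1, 1 + 1]
  let x2 : Fin 2 → S := ![1 + 1, 1]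
  let L : Submodule S (Fin 2 → S) := Submodule.span S {x1, x2}
  have hL : L.FG := Submodule.fg_span (by simp)
  have hmem : ∀ z : L, ∃ p q : S, p • x1 + q • x2 = z := fun z =>
    Submodule.mem_span_pair.1 z.2
  choose P Q hPQ using hmem
  have wd' : ∀ (z : L) (p q : S), p • x1 + q • x2 = z →
      P z + P z + 7 • Q z = p + p + 7 • q := by
    intro z p q h
    have h' := (hPQ z).trans h.symm
    have h0 := congrFun h' 0
    have h1 := congrFun h' 1
    simp [x1, x2, mul_add] at h0 h1
    exact wd _ _ _ _ h0 h1
  let φ : L →ₗ[S] S :=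
    { toFun := fun z => P z + P z + 7 • Q z
      map_add' := fun z w => by
        rw [wd' (z + w) (P z + P w) (Q z + Q w) (by
          rw [Submodule.coe_add, ← hPQ z, ← hPQ w, add_smul, add_smul]; abel)]
        abel
      map_smul' := fun c z => by
        rw [wd' (c • z) (c * P z) (c * Q z) (by
          rw [Submodule.coe_smul, ← hPQ z, smul_add, mul_smul, mul_smul])]
        rw [RingHom.id_apply, smul_eq_mul, mul_add, mul_add, mul_smul_comm] }
  obtain ⟨ψ, hψ⟩ := hS 2 L hL φ
  have m1 : x1 ∈ L := Submodule.subset_span (by simp)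
  have m2 : x2 ∈ L := Submodule.subset_span (by simp)
  have v1 : φ ⟨x1, m1⟩ = 1 + 1 := (wd' ⟨x1, m1⟩ 1 0 (by simp)).trans (by simp)
  have v2 : φ ⟨x2, m2⟩ = 7 • 1 := (wd' ⟨x2, m2⟩ 0 1 (by simp)).trans (by simp)
  obtain ⟨u, hu⟩ : ∃ u, u = ψ ![1, 0] := ⟨_, rfl⟩
  obtain ⟨v, hv⟩ : ∃ v, v = ψ ![0, 1] := ⟨_, rfl⟩
  have d1 : x1 = ![1, 0] + (![0, 1] + ![0, 1]) := by
    ext i; fin_cases i <;> simp [x1]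
  have d2 : x2 = (![1, 0] + ![1, 0]) + ![0, 1] := by
    ext i; fin_cases i <;> simp [x2]
  have w1 : u + (v + v) = 1 + 1 := by
    rw [← v1, ← hψ x1 m1, d1, map_add, map_add, ← hu, ← hv]
  have w2 : (u + u) + v = 7 • 1 := by
    rw [← v2, ← hψ x2 m2, d2, map_add, map_add, ← hu, ← hv]
  have k1 : 7 • (1 : S) + 3 • v = 4 • 1 := by
    rw [← w2]
    calc u + u + v + 3 • v = 2 • (u + (v + v)) := by abel
      _ = 2 • (1 + 1) := by rw [w1]
      _ = 4 • 1 := by abel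
  obtain ⟨a, ha⟩ : ∃ a, a = 3 • (1 : S) + 3 • v := ⟨_, rfl⟩
  have k2 : 4 • (1 : S) + a = 4 • 1 := by
    rw [ha, ← add_assoc, ← add_smul]; exact k1
  have k3 : a + a = a + a + a := by
    have e : a + a = 4 • 1 + (2 • 1 + 6 • v) := by rw [ha]; abel
    calc a + a = 4 • 1 + (2 • 1 + 6 • v) := e
      _ = (4 • 1 + a) + (2 • 1 + 6 • v) := by rw [k2]
      _ = (4 • 1 + (2 • 1 + 6 • v)) + a := by abel
      _ = a + a + a := by rw [← e]
  have k4 : a + a = (a + a) + (a + a) := by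
    rw [← add_assoc, ← k3, ← k3]
  have k5 : a = a + a := cancel2 _ _ k4
  have ha0 : a ≠ 0 := fun h => hinv ⟨2 • 1 + 3 • v, by rw [← h, ha]; abel⟩
  apply mul_left_cancel₀ ha0
  rw [mul_add, mul_one, ← k5]

/-- A semifield `S` is left exact iff `S` is a division ring (every element has an
additive inverse) or `1 + 1 = 1` in `S`. -/
theorem semifield_isLeftExact_iff (S : Type*) [DivisionSemiring S] :
    IsLeftExact S ↔ (∀ x : S, ∃ y : S, x + y = 0) ∨ (1 + 1 : S) = 1 := by
  constructor
  · exact of_isLeftExact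
  · rintro (h | h)
    · exact isLeftExact_of_neg S h
    · exact isLeftExact_of_idem h
end

section
/- Let S be a semiring. Then S is left exact if and only if S satisfies condition (E2): for all natural numbers d and n, every matrix A ∈ Matrix (Fin d) (Fin n) S and every vector b : Fin d → S, if left ker A ⊆ left ker b then b ∈ right im A. -/
open Matrix

/-- A semiring is left exact iff it satisfies condition (E2): whenever the left kernel of a
matrix `A` is contained in the left kernel of a vector `b`, `b` is in the right image of `A`. -/
theorem isLeftExact_iff_E2 (S : Type*) [Semiring S] :
    IsLeftExact S ↔
      ∀ (d n : ℕ) (A : Matrix (Fin d) (Fin n) S) (b : Fin d → S),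
        (∀ u v : Fin d → S, u ᵥ* A = v ᵥ* A → u ⬝ᵥ b = v ⬝ᵥ b) →
        ∃ w : Fin n → S, A *ᵥ w = b := by
  constructor
  · intro h d n A b hab
    have hfg : (LinearMap.range A.vecMulLinear).FG := by
      rw [LinearMap.range_eq_map]
      exact Submodule.FG.map _ Module.Finite.fg_top
    have hch : ∀ x : LinearMap.range A.vecMulLinear, ∃ u : Fin d → S, u ᵥ* A = x.1 := by
      rintro ⟨x, u, hu⟩
      exact ⟨u, hu⟩
    choose f hf using hch
    let φ : LinearMap.range A.vecMulLinear →ₗ[S] S :=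
      { toFun := fun x => f x ⬝ᵥ b
        map_add' := by
          intro x y
          rw [← add_dotProduct]
          apply hab
          rw [add_vecMul, hf, hf, hf]
          rfl
        map_smul' := by
          intro c x
          rw [RingHom.id_apply, ← smul_dotProduct]
          apply hab
          rw [smul_vecMul, hf, hf]
          rfl }
    obtain ⟨ψ, hψ⟩ := h n _ hfg φ
    refine ⟨fun j => ψ (Pi.single j 1), ?_⟩
    funext i
    have hi : (Pi.single i 1 : Fin d → S) ᵥ* A = A i := by
      rw [single_one_vecMul]
      rfl
    have hmem : A i ∈ LinearMap.range A.vecMulLinear := ⟨Pi.single i 1, hi⟩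
    have h1 : ψ (A i) = b i := by
      rw [hψ _ hmem]
      change f ⟨A i, hmem⟩ ⬝ᵥ b = b i
      rw [hab _ (Pi.single i 1) (by rw [hf, hi]), single_one_dotProduct]
    rw [← h1, LinearMap.pi_apply_eq_sum_univ ψ (A i)]
    simp only [mulVec, dotProduct, smul_eq_mul]
    refine Finset.sum_congr rfl fun j _ => ?_
    congr 2
    funext k
    simp [Pi.single_apply, eq_comm]
  · intro h n L hL φ
    obtain ⟨d, g, rfl⟩ := Submodule.fg_iff_exists_fin_generating_family.mp hL
    have hg : ∀ i, g i ∈ Submodule.span S (Set.range g) :=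
      fun i => Submodule.subset_span ⟨i, rfl⟩
    have hφ : ∀ u : Fin d → S, ∀ hu : u ᵥ* (Matrix.of g) ∈ Submodule.span S (Set.range g),
        u ⬝ᵥ (fun i => φ ⟨g i, hg i⟩) = φ ⟨u ᵥ* (Matrix.of g), hu⟩ := by
      intro u hu
      have : (⟨u ᵥ* (Matrix.of g), hu⟩ : Submodule.span S (Set.range g)) =
          ∑ i, u i • ⟨g i, hg i⟩ := by
        apply Subtype.ext
        funext j
        simp [vecMul, dotProduct]
      rw [this, map_sum]
      exact Finset.sum_congr rfl fun i _ => (map_smul φ (u i) ⟨g i, hg i⟩).symm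
    have hm : ∀ u : Fin d → S, u ᵥ* (Matrix.of g) ∈ Submodule.span S (Set.range g) := by
      intro u
      have : u ᵥ* (Matrix.of g) = ∑ i, u i • g i := by
        funext j
        simp [vecMul, dotProduct]
      rw [this]
      exact Submodule.sum_mem _ fun i _ => Submodule.smul_mem _ _ (hg i)
    obtain ⟨w, hw⟩ := h d n (Matrix.of g) (fun i => φ ⟨g i, hg i⟩) (by
      intro u v huv
      rw [hφ u (hm u), hφ v (hm v)]
      congr 2)
    let ψ : (Fin n → S) →ₗ[S] S :=
      { toFun := fun x => x ⬝ᵥ w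
        map_add' := fun x y => add_dotProduct x y w
        map_smul' := fun c x => smul_dotProduct c x w }
    refine ⟨ψ, fun x hx => ?_⟩
    induction hx using Submodule.span_induction with
    | mem x hx =>
      obtain ⟨i, rfl⟩ := hx
      exact congrFun hw i
    | zero => exact (map_zero ψ).trans (map_zero φ).symm
    | add x y hx hy ihx ihy =>
      rw [map_add, ihx, ihy, ← map_add]
      rfl
    | smul c x hx ih =>
      rw [map_smul, ih, ← map_smul]
      rfl
end

section
/- Every left exact semiring S contains an element e such that 1 + 1 + e = 1. -/
open Matrix

/-- Any left exact semiring contains an element `e` such that `1 + 1 + e = 1`. -/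
theorem exists_of_isLeftExact (S : Type*) [Semiring S] (hS : IsLeftExact S) :
    ∃ e : S, 1 + 1 + e = 1 := by
  let F : (Fin 3 → S) →ₗ[S] (Fin 3 → S) :=
    { toFun := fun s => ![s 1, s 0 + s 1, s 1 + s 2]
      map_add' := by
        intro a b
        ext i
        fin_cases i <;> simp <;> abel
      map_smul' := by
        intro c a
        ext i
        fin_cases i <;> simp [mul_add] }
  let G : (Fin 3 → S) →ₗ[S] S :=
    { toFun := fun s => s 0 + s 1 + s 2
      map_add' := by
        intro a b
        simp only [Pi.add_apply]
        abel
      map_smul' := by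
        intro c a
        simp [mul_add] }
  have key : ∀ s t, F s = F t → G s = G t := by
    intro s t h
    have h0 : s 1 = t 1 := congrFun h 0
    have h1 : s 0 + s 1 = t 0 + t 1 := congrFun h 1
    have h2 : s 1 + s 2 = t 1 + t 2 := congrFun h 2
    change s 0 + s 1 + s 2 = t 0 + t 1 + t 2
    rw [h1, ← h0, add_assoc, h2, add_assoc, h0]
  have hex : ∀ l : LinearMap.range F, ∃ s, F s = l := fun l => l.2
  choose p hp using hex
  let φ : LinearMap.range F →ₗ[S] S :=
    { toFun := fun l => G (p l)
      map_add' := by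
        intro a b
        rw [← map_add]
        apply key
        rw [map_add, hp, hp, hp]
        rfl
      map_smul' := by
        intro c a
        rw [RingHom.id_apply, ← map_smul]
        apply key
        rw [map_smul, hp, hp]
        rfl }
  have hfg : (LinearMap.range F).FG := by
    rw [LinearMap.range_eq_map]
    exact (Module.Finite.fg_top).map F
  obtain ⟨ψ, hψ⟩ := hS 3 _ hfg φ
  have hG : ∀ s, ψ (F s) = G s := by
    intro s
    rw [hψ (F s) ⟨s, rfl⟩]
    exact key _ _ (hp _)
  have e0 : F ![1, 0, 0] = Pi.single 1 1 := by
    ext i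
    fin_cases i <;> simp [F]
  have e2 : F ![0, 0, 1] = Pi.single 2 1 := by
    ext i
    fin_cases i <;> simp [F]
  have e1 : F ![0, 1, 0] = Pi.single 1 1 + Pi.single 2 1 + Pi.single 0 1 := by
    ext i
    fin_cases i <;> simp [F]
  have g0 := hG ![1, 0, 0]
  have g1 := hG ![0, 1, 0]
  have g2 := hG ![0, 0, 1]
  rw [e0] at g0
  rw [e2] at g2
  rw [e1, map_add, map_add, g0, g2] at g1
  refine ⟨ψ (Pi.single 0 1), ?_⟩
  simpa [G] using g1
end

section
/- Let S be a left exact semifield (a division semiring that is left exact). Then either every element of S has an additive inverse (so S is a division ring), or 1 + 1 = 1 holds in S. -/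
open Matrix

theorem semifield_ring_of_neg_one {S : Type*} [DivisionSemiring S] (y : S) (h : 1 + y = 0) :
    ∀ x : S, ∃ y : S, x + y = 0 := fun x => ⟨x * y, by
  have : x * (1 + y) = 0 := by rw [h, mul_zero]
  rwa [mul_add, mul_one] at this⟩

/-- The key cancellation: `(p + 2q, 2p + q)` determines `4p + q` when `3 ≠ 0`. -/
theorem semifield_key {S : Type*} [DivisionSemiring S] (h3 : (1 + 1 + 1 : S) ≠ 0) (p q p' q' : S)
    (h1 : p + (q + q) = p' + (q' + q')) (h2 : (p + p) + q = (p' + p') + q') :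
    (p + p + p + p) + q = (p' + p' + p' + p') + q' := by
  have hs : p + q = p' + q' := by
    apply mul_left_cancel₀ h3
    calc (1 + 1 + 1) * (p + q) = (p + (q + q)) + ((p + p) + q) := by
          simp only [add_mul, one_mul]; abel
      _ = (p' + (q' + q')) + ((p' + p') + q') := by rw [h1, h2]
      _ = _ := by simp only [add_mul, one_mul]; abel
  have hp : (p + q) + p = (p + q) + p' := by
    calc (p + q) + p = (p + p) + q := by abel
      _ = (p' + p') + q' := h2
      _ = (p' + q') + p' := by abel
      _ = _ := by rw [hs]
  calc (p + p + p + p) + q = ((p + q) + p) + p + p := by abel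
    _ = ((p + q) + p) + p + p' := by rw [hp]; simp only [add_right_comm _ p' p, hp]
    _ = ((p + q) + p) + p' + p' := by rw [add_right_comm _ p p', hp]; simp only [add_right_comm _ p' p, hp]
    _ = ((p' + q') + p') + p' + p' := by rw [hp, hs]
    _ = _ := by abel

/-- Any left exact semifield is either a ring (every element has an additive inverse)
or satisfies `1 + 1 = 1`. -/
theorem leftExact_semifield_ring_or_idem (S : Type*) [DivisionSemiring S]
    (hS : IsLeftExact S) :
    (∀ x : S, ∃ y : S, x + y = 0) ∨ (1 + 1 : S) = 1 := by
  by_cases hr : ∃ y : S, 1 + y = 0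
  · obtain ⟨y, hy⟩ := hr
    exact Or.inl (semifield_ring_of_neg_one y hy)
  right
  have hr' : ∀ y : S, 1 + y ≠ 0 := fun y hy => hr ⟨y, hy⟩
  have h3 : (1 + 1 + 1 : S) ≠ 0 := by rw [add_assoc]; exact hr' _
  have h2 : (1 + 1 : S) ≠ 0 := hr' _
  let u : Fin 2 → S := ![1, 1 + 1]
  let v : Fin 2 → S := ![1 + 1, 1]
  let L : Submodule S (Fin 2 → S) := Submodule.span S {u, v}
  have hL : L.FG := Submodule.fg_span (by simp)
  have hex : ∀ x : L, ∃ a b : S, a • u + b • v = x.1 := fun x =>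
    Submodule.mem_span_pair.1 x.2
  choose a b hab using hex
  have key : ∀ (p q p' q' : S), p • u + q • v = p' • u + q' • v →
      (p + p + p + p) + q = (p' + p' + p' + p') + q' := by
    intro p q p' q' h
    apply semifield_key h3
    · simpa [u, v, mul_add] using congrFun h 0
    · simpa [u, v, mul_add] using congrFun h 1
  let φ : L →ₗ[S] S :=
    { toFun := fun x => (a x + a x + a x + a x) + b x
      map_add' := by
        intro x y
        rw [key (a (x + y)) (b (x + y)) (a x + a y) (b x + b y)]
        · abel
        · rw [hab, Submodule.coe_add, ← hab x, ← hab y, add_smul, add_smul]; abel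
      map_smul' := by
        intro r x
        rw [key (a (r • x)) (b (r • x)) (r * a x) (r * b x)]
        · simp [mul_add]
        · rw [hab, Submodule.coe_smul, ← hab x, smul_add, mul_smul, mul_smul] }
  obtain ⟨ψ, hψ⟩ := hS 2 L hL φ
  have hu : u ∈ L := Submodule.subset_span (by simp)
  have hv : v ∈ L := Submodule.subset_span (by simp)
  have e1 : ψ u = 1 + 1 + 1 + 1 := by
    rw [hψ u hu]
    have := key (a ⟨u, hu⟩) (b ⟨u, hu⟩) 1 0 (by rw [hab]; simp)
    exact this.trans (by simp)
  have e2 : ψ v = 1 := by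
    rw [hψ v hv]
    have := key (a ⟨v, hv⟩) (b ⟨v, hv⟩) 0 1 (by rw [hab]; simp)
    exact this.trans (by simp)
  have huv : v + v = u + (![1, 0] + ![1, 0] + ![1, 0] : Fin 2 → S) := by
    ext i
    fin_cases i
    · simp [u, v]; abel
    · simp [u, v]
  have e3 := congrArg ψ huv
  simp only [map_add, e1, e2] at e3
  set c := ψ ![1, 0]
  let t : S := (1 + 1)⁻¹ * (c + c + c)
  have ht : (1 + 1) + t = (1 : S) := by
    apply mul_left_cancel₀ h2
    rw [mul_add, mul_inv_cancel_left₀ h2, mul_one]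
    refine Eq.trans ?_ e3.symm
    simp only [mul_add, mul_one, add_assoc]
  have hz : (1 + t) + (1 + t) = 1 + t := by
    calc (1 + t) + (1 + t) = ((1 + 1) + t) + t := by abel
      _ = _ := by rw [ht]
  apply mul_left_cancel₀ (hr' t)
  rw [mul_add, mul_one, hz]
end

section
/- Let S be a zero-sum-free semifield (a division semiring in which a + b = 0 implies a = 0 and b = 0). Then S satisfies condition (E2) if and only if S satisfies condition (E2'): for all d, n, every column-stochastic matrix A ∈ Matrix (Fin d) (Fin n) S and every vector b : Fin d → S all of whose entries are 0 or 1, the condition left ker A ⊆ left ker b implies b ∈ right im A. -/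
open Matrix

/-- In a zero-sum-free semifield, condition (E2) is equivalent to its restriction (E2') to
column-stochastic matrices `A` and `0`-`1` vectors `b`. -/
theorem E2_iff_E2' (S : Type*) [DivisionSemiring S]
    (hzsf : ∀ a b : S, a + b = 0 → a = 0 ∧ b = 0) :
    (∀ (d n : ℕ) (A : Matrix (Fin d) (Fin n) S) (b : Fin d → S),
        (∀ u v : Fin d → S, u ᵥ* A = v ᵥ* A → u ⬝ᵥ b = v ⬝ᵥ b) →
        ∃ w : Fin n → S, A *ᵥ w = b) ↔
      (∀ (d n : ℕ) (A : Matrix (Fin d) (Fin n) S) (b : Fin d → S),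
        (∀ j, ∑ i, A i j = 1) → (∀ i, b i = 0 ∨ b i = 1) →
        (∀ u v : Fin d → S, u ᵥ* A = v ᵥ* A → u ⬝ᵥ b = v ⬝ᵥ b) →
        ∃ w : Fin n → S, A *ᵥ w = b) := by
  constructor
  · intro h d n A b _ _ hk
    exact h d n A b hk
  intro h d n A b hk
  classical
  have hsum : ∀ {d : ℕ} (f : Fin d → S), ∑ i, f i = 0 → ∀ i, f i = 0 := by
    intro d f hf i
    rw [← Finset.add_sum_erase _ _ (Finset.mem_univ i)] at hf
    exact (hzsf _ _ hf).1
  let c : Fin d → S := fun i => if b i = 0 then 1 else (b i)⁻¹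
  have hc : ∀ i, c i ≠ 0 := by
    intro i
    by_cases hb : b i = 0 <;> simp [c, hb]
  let s : Fin n → S := fun j => ∑ i, c i * A i j
  have hs : ∀ j, s j = 0 → ∀ i, A i j = 0 := by
    intro j hj i
    have := hsum _ hj i
    simpa [hc i] using this
  by_cases hall : ∀ j, s j = 0
  · refine ⟨0, ?_⟩
    ext i
    have := hk (Pi.single i 1) 0 (by
      ext j
      simp [hs j (hall j)])
    simpa using this.symm
  · push Not at hall
    obtain ⟨j0, hj0⟩ := hall
    let f : Fin n → Fin n := fun j => if s j = 0 then j0 else j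
    have hf : ∀ j, s (f j) ≠ 0 := by
      intro j
      by_cases hj : s j = 0 <;> simp [f, hj, hj0]
    obtain ⟨w, hw⟩ := h d n (fun i j => c i * A i (f j) * (s (f j))⁻¹) (fun i => c i * b i)
      (by
        intro j
        rw [← Finset.sum_mul]
        exact mul_inv_cancel₀ (hf j))
      (by
        intro i
        by_cases hb : b i = 0 <;> simp [c, hb])
      (by
        intro u v huv
        have := hk (fun i => u i * c i) (fun i => v i * c i) (by
          ext j
          by_cases hj : s j = 0
          · simp [Matrix.vecMul, dotProduct, hs j hj]
          · have e := congrFun huv j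
            have fj : f j = j := by simp [f, hj]
            simp only [Matrix.vecMul, dotProduct, fj, ← mul_assoc, ← Finset.sum_mul] at e ⊢
            exact mul_right_cancel₀ (inv_ne_zero hj) e)
        simpa only [dotProduct, mul_assoc] using this)
    refine ⟨fun k => ∑ j, if f j = k then (s k)⁻¹ * w j else 0, ?_⟩
    ext i
    have e := congrFun hw i
    apply mul_left_cancel₀ (hc i)
    rw [← e]
    simp only [Matrix.mulVec, dotProduct, Finset.mul_sum, mul_assoc]
    rw [Finset.sum_comm]
    refine Finset.sum_congr rfl fun j _ => ?_
    simp
end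

section
/- Let S be an idempotent semifield (a division semiring with 1 + 1 = 1) containing at least three elements, and let A ∈ Matrix (Fin d) (Fin n) S be a column-stochastic matrix that is not row-stochastic. Then there exists a row vector Λ : Fin d → S such that Λ ᵥ* A is the all-ones vector in Fin n → S, while Λ is not ≤ the all-ones vector of Fin d → S (i.e., the coordinatewise sum of the all-ones vector and Λ differs from the all-ones vector). -/
open Matrix

theorem aux_add_self {S : Type*} [DivisionSemiring S] (hidem : (1 + 1 : S) = 1) (x : S) :
    x + x = x := by
  have := congrArg (fun t => x * t) hidem
  simpa [mul_add] using this

/-- a term is below the sum -/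
theorem aux_le_sum {S : Type*} [DivisionSemiring S] (hidem : (1 + 1 : S) = 1)
    {m : ℕ} (f : Fin m → S) (k : Fin m) : f k + ∑ i, f i = ∑ i, f i := by
  rw [← Finset.add_sum_erase _ _ (Finset.mem_univ k), ← add_assoc, aux_add_self hidem]

theorem aux_sum_le {S : Type*} [DivisionSemiring S]
    {m : ℕ} (f : Fin m → S) (h : ∀ i, f i + 1 = 1) : ∑ i, f i + 1 = 1 := by
  have : ∀ s : Finset (Fin m), ∑ i ∈ s, f i + 1 = 1 := by
    intro s
    induction s using Finset.induction_on with
    | empty => simp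
    | insert a s ha ih => rw [Finset.sum_insert ha, add_assoc, ih, h]
  exact this _

theorem aux_lambda {S : Type*} [DivisionSemiring S] (hidem : (1 + 1 : S) = 1)
    (hcard : ∃ a b c : S, a ≠ b ∧ a ≠ c ∧ b ≠ c) : ∃ l : S, l + 1 = l ∧ l ≠ 1 := by
  obtain ⟨x, hx0, hx1⟩ : ∃ x : S, x ≠ 0 ∧ x ≠ 1 := by
    by_contra! h
    obtain ⟨a, b, c, hab, hac, hbc⟩ := hcard
    have ha := h a
    have hb := h b
    have hc := h c
    by_cases a0 : a = 0
    · have b1 := hb (fun e => hab (a0.trans e.symm))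
      have c1 := hc (fun e => hac (a0.trans e.symm))
      exact hbc (b1.trans c1.symm)
    · have a1 := ha a0
      by_cases b0 : b = 0
      · exact hac (a1.trans (hc (fun e => hbc (b0.trans e.symm))).symm)
      · exact hab (a1.trans (hb b0).symm)
  by_cases h : x + 1 = 1
  · refine ⟨x⁻¹, ?_, by simpa using hx1⟩
    have := congrArg (fun t => x⁻¹ * t) h
    simp only [mul_add, inv_mul_cancel₀ hx0, mul_one] at this
    rwa [add_comm]
  · exact ⟨x + 1, by rw [add_assoc, hidem], h⟩

/-- In an idempotent semifield with at least three elements, for any column-stochastic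
matrix `A` that is not row-stochastic there is a row vector `Λ` with `Λ ᵥ* A = (1,…,1)`
and `Λ ≰ (1,…,1)`. -/
theorem exists_row_vector_of_column_stochastic (S : Type*) [DivisionSemiring S]
    (hidem : (1 + 1 : S) = 1)
    (hcard : ∃ a b c : S, a ≠ b ∧ a ≠ c ∧ b ≠ c)
    {d n : ℕ} (A : Matrix (Fin d) (Fin n) S)
    (hcol : ∀ j, ∑ i, A i j = 1) (hrow : ¬ ∀ i, ∑ j, A i j = 1) :
    ∃ Λ : Fin d → S, Λ ᵥ* A = (fun _ => 1) ∧
      (fun _ => (1 : S)) + Λ ≠ (fun _ => (1 : S)) := by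
  push Not at hrow
  obtain ⟨i, hi⟩ := hrow
  have hA : ∀ k j, A k j + 1 = 1 := fun k j => by
    have := aux_le_sum hidem (fun k => A k j) k
    rwa [hcol] at this
  obtain ⟨l, hl, hl1, hlA⟩ : ∃ l : S, l + 1 = l ∧ l ≠ 1 ∧ ∀ j, l * A i j + 1 = 1 := by
    by_cases hr : ∑ j, A i j = 0
    · obtain ⟨l, hl, hl1⟩ := aux_lambda hidem hcard
      refine ⟨l, hl, hl1, fun j => ?_⟩
      have := aux_le_sum hidem (A i) j
      rw [hr, add_zero] at this
      simp [this]
    · have h1 := aux_sum_le (A i) (hA i)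
      have h2 := aux_le_sum hidem (A i)
      generalize ∑ j, A i j = r at *
      refine ⟨r⁻¹, ?_, by simpa using hi, fun j => ?_⟩
      · have := congrArg (fun t => r⁻¹ * t) h1
        simp only [mul_add, inv_mul_cancel₀ hr, mul_one] at this
        rwa [add_comm]
      · have := congrArg (fun t => r⁻¹ * t) (h2 j)
        simpa only [mul_add, inv_mul_cancel₀ hr] using this
  refine ⟨Function.update (fun _ => 1) i l, ?_, ?_⟩
  · funext j
    have hL : ∀ k, Function.update (fun _ => (1 : S)) i l k + 1
        = Function.update (fun _ => (1 : S)) i l k := by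
      intro k
      by_cases hk : k = i
      · subst hk; simpa using hl
      · simpa [hk] using hidem
    have hT : ∀ k, Function.update (fun _ => (1 : S)) i l k * A k j + 1 = 1 := by
      intro k
      by_cases hk : k = i
      · subst hk; simpa using hlA j
      · simpa [hk] using hA k j
    change ∑ k, Function.update (fun _ => (1 : S)) i l k * A k j = 1
    generalize Function.update (fun _ => (1 : S)) i l = L at *
    refine Eq.trans ?_ (aux_sum_le _ hT)
    conv_rhs => rw [← hcol j, ← Finset.sum_add_distrib]
    refine Finset.sum_congr rfl fun k _ => ?_
    conv_lhs => rw [← hL k, add_mul, one_mul]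
  · intro h
    have := congrFun h i
    simp only [Pi.add_apply, Function.update_self] at this
    rw [add_comm, hl] at this
    exact hl1 this
end

section
/- Let S be an idempotent semifield (a division semiring with 1 + 1 = 1) containing at least three elements, let A ∈ Matrix (Fin d) (Fin n) S be a column-stochastic matrix, and let b : Fin d → S be a vector all of whose entries are 0 or 1 such that b ∉ right im A. Then there exist row vectors u v : Fin d → S with u ᵥ* A = v ᵥ* A and u ⬝ᵥ b ≠ v ⬝ᵥ b. -/
open Matrix

theorem idem_sum_le {S : Type*} [DivisionSemiring S] [PartialOrder S] [IsOrderedRing S]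
    [CanonicallyOrderedAdd S] (hid : ∀ x : S, x + x = x) {ι : Type*} (s : Finset ι) (f : ι → S)
    (c : S) (h : ∀ i ∈ s, f i ≤ c) : ∑ i ∈ s, f i ≤ c := by
  classical
  induction s using Finset.induction_on with
  | empty => simp
  | insert a s ha ih =>
    rw [Finset.sum_insert ha, ← hid c]
    exact add_le_add (h a (by simp)) (ih fun i hi => h i (by simp [hi]))

theorem idem_term_le {S : Type*} [DivisionSemiring S] [PartialOrder S] [IsOrderedRing S]
    [CanonicallyOrderedAdd S] {ι : Type*} [Fintype ι] (f : ι → S)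
    (i : ι) : f i ≤ ∑ i, f i :=
  Finset.single_le_sum (f := f) (fun _ _ => zero_le) (Finset.mem_univ i)

theorem idem_exists_scale {S : Type*} [DivisionSemiring S] [PartialOrder S] [IsOrderedRing S]
    [CanonicallyOrderedAdd S] (hcard : ∃ a b c : S, a ≠ b ∧ a ≠ c ∧ b ≠ c)
    (s : S) (hs : s ≤ 1) (hs1 : s ≠ 1) : ∃ t : S, 1 ≤ t ∧ ¬ t ≤ 1 ∧ t * s ≤ 1 := by
  have key : ∀ s : S, s ≤ 1 → s ≠ 1 → s ≠ 0 → 1 ≤ s⁻¹ ∧ ¬ s⁻¹ ≤ 1 ∧ s⁻¹ * s ≤ 1 := by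
    intro s hs hs1 h0
    refine ⟨?_, fun h => hs1 (le_antisymm hs ?_), (inv_mul_cancel₀ h0).le⟩
    · calc (1 : S) = s⁻¹ * s := (inv_mul_cancel₀ h0).symm
        _ ≤ s⁻¹ * 1 := mul_le_mul_of_nonneg_left hs zero_le
        _ = s⁻¹ := mul_one _
    · calc (1 : S) = s * s⁻¹ := (mul_inv_cancel₀ h0).symm
        _ ≤ s * 1 := mul_le_mul_of_nonneg_left h zero_le
        _ = s := mul_one _
  by_cases h0 : s = 0
  · subst h0
    obtain ⟨g, hg0, hg1⟩ : ∃ g : S, g ≠ 0 ∧ g ≠ 1 := by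
      obtain ⟨a, b, c, h1, h2, h3⟩ := hcard
      by_contra! h
      by_cases ha : a = 0 <;> by_cases hb : b = 0 <;> by_cases hc : c = 0 <;> simp_all
    by_cases hg : g ≤ 1
    · obtain ⟨h1, h2, -⟩ := key g hg hg1 hg0
      exact ⟨g⁻¹, h1, h2, by simp⟩
    · exact ⟨1 + g, le_self_add, fun h => hg (le_add_self.trans h), by simp⟩
  · exact ⟨_, key s hs hs1 h0⟩

theorem idem_main {S : Type*} [DivisionSemiring S] [PartialOrder S] [IsOrderedRing S]
    [CanonicallyOrderedAdd S] (hid : ∀ x : S, x + x = x)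
    (hcard : ∃ a b c : S, a ≠ b ∧ a ≠ c ∧ b ≠ c)
    {d n : ℕ} (A : Matrix (Fin d) (Fin n) S)
    (hcol : ∀ j, ∑ i, A i j = 1)
    (b : Fin d → S) (hb : ∀ i, b i = 0 ∨ b i = 1)
    (hbim : ¬ ∃ w : Fin n → S, A *ᵥ w = b) :
    ∃ u v : Fin d → S, u ᵥ* A = v ᵥ* A ∧ u ⬝ᵥ b ≠ v ⬝ᵥ b := by
  classical
  have hA1 : ∀ i j, A i j ≤ 1 := fun i j => hcol j ▸ idem_term_le (fun i => A i j) i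
  let w : Fin n → S := fun j => if ∀ i, b i = 0 → A i j = 0 then 1 else 0
  obtain ⟨i0, hi0⟩ : ∃ i, (A *ᵥ w) i ≠ b i := by
    by_contra! h
    exact hbim ⟨w, funext h⟩
  have hs : (A *ᵥ w) i0 ≤ 1 := by
    show ∑ j, A i0 j * w j ≤ 1
    refine idem_sum_le hid _ _ _ fun j _ => ?_
    by_cases h : ∀ i, b i = 0 → A i j = 0
    · have hw : w j = 1 := if_pos h
      rw [hw, mul_one]
      exact hA1 i0 j
    · simp [w, h]
  have hb0 : b i0 ≠ 0 := by
    intro h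
    apply hi0
    rw [h]
    show ∑ j, A i0 j * w j = 0
    refine Finset.sum_eq_zero fun j _ => ?_
    by_cases h' : ∀ i, b i = 0 → A i j = 0
    · simp [h' i0 h]
    · simp [w, h']
  have hb1 : b i0 = 1 := (hb i0).resolve_left hb0
  rw [hb1] at hi0
  obtain ⟨t, ht1, ht, hts⟩ := idem_exists_scale hcard _ hs hi0
  let M : S := ∑ i, ∑ j, t * (A i j)⁻¹
  have hM : ∀ i j, A i j ≠ 0 → t ≤ M * A i j := by
    intro i j h
    calc t = t * (A i j)⁻¹ * A i j := by rw [mul_assoc, inv_mul_cancel₀ h, mul_one]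
      _ ≤ M * A i j := mul_le_mul_of_nonneg_right
        ((idem_term_le (fun j => t * (A i j)⁻¹) j).trans
          (idem_term_le (fun i => ∑ j, t * (A i j)⁻¹) i)) zero_le
  let u : Fin d → S := fun i => if b i = 0 then M else 1
  let v : Fin d → S := fun i => if i = i0 then t else u i
  have hu0 : u i0 = 1 := by simp [u, hb0]
  have huv : ∀ i, u i ≤ v i := by
    intro i
    by_cases h : i = i0
    · subst h
      simpa [v, hu0] using ht1
    · simp [v, h]
  refine ⟨u, v, funext fun j => le_antisymm ?_ ?_, fun h => ht ?_⟩
  · show ∑ i, u i * A i j ≤ ∑ i, v i * A i j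
    exact Finset.sum_le_sum fun i _ => mul_le_mul_of_nonneg_right (huv i) zero_le
  · show ∑ i, v i * A i j ≤ ∑ i, u i * A i j
    refine idem_sum_le hid _ _ _ fun i _ => ?_
    by_cases hi : i = i0
    · subst hi
      have hv : v i = t := by simp [v]
      show v i * A i j ≤ _
      rw [hv]
      by_cases hj : ∀ i, b i = 0 → A i j = 0
      · calc t * A i j ≤ t * (A *ᵥ w) i := by
              refine mul_le_mul_of_nonneg_left ?_ zero_le
              have := idem_term_le (fun j => A i j * w j) j
              have hw : w j = 1 := if_pos hj
              simp only [hw, mul_one] at this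
              exact this
          _ ≤ 1 := hts
          _ = ∑ i, A i j := (hcol j).symm
          _ ≤ ∑ i, u i * A i j := by
              refine Finset.sum_le_sum fun k _ => ?_
              by_cases hk : b k = 0
              · simp [hj k hk]
              · simp [u, hk]
      · push Not at hj
        obtain ⟨k, hk, hkj⟩ := hj
        calc t * A i j ≤ t * 1 := mul_le_mul_of_nonneg_left (hA1 i j) zero_le
          _ = t := mul_one t
          _ ≤ M * A k j := hM k j hkj
          _ = u k * A k j := by simp [u, hk]
          _ ≤ ∑ i, u i * A i j := idem_term_le (fun i => u i * A i j) k
    · have hv : v i = u i := by simp [v, hi]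
      show v i * A i j ≤ _
      rw [hv]
      exact idem_term_le (fun i => u i * A i j) i
  · calc t = v i0 * b i0 := by simp [v, hb1]
      _ ≤ v ⬝ᵥ b := idem_term_le (fun i => v i * b i) i0
      _ = u ⬝ᵥ b := h.symm
      _ ≤ 1 := by
        refine idem_sum_le hid _ _ _ fun i _ => ?_
        rcases hb i with h | h <;> simp [u, h]

/-- In an idempotent semifield with at least three elements, if `A` is column-stochastic
and `b` is a `0`-`1` vector outside the right image of `A`, then there are row vectors
`u`, `v` with `u ᵥ* A = v ᵥ* A` and `u ⬝ᵥ b ≠ v ⬝ᵥ b`. -/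
theorem exists_kernel_witness (S : Type*) [DivisionSemiring S]
    (hidem : (1 + 1 : S) = 1)
    (hcard : ∃ a b c : S, a ≠ b ∧ a ≠ c ∧ b ≠ c)
    {d n : ℕ} (A : Matrix (Fin d) (Fin n) S)
    (hcol : ∀ j, ∑ i, A i j = 1)
    (b : Fin d → S) (hb : ∀ i, b i = 0 ∨ b i = 1)
    (hbim : ¬ ∃ w : Fin n → S, A *ᵥ w = b) :
    ∃ u v : Fin d → S, u ᵥ* A = v ᵥ* A ∧ u ⬝ᵥ b ≠ v ⬝ᵥ b := by
  have hid : ∀ x : S, x + x = x := fun x => by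
    calc x + x = x * (1 + 1) := by rw [mul_add, mul_one]
      _ = x := by rw [hidem, mul_one]
  letI : PartialOrder S :=
    { le := fun x y => x + y = y
      le_refl := hid
      le_trans := fun x y z (h1 : x + y = y) (h2 : y + z = z) =>
        show x + z = z by rw [← h2, ← add_assoc, h1]
      le_antisymm := fun x y (h1 : x + y = y) (h2 : y + x = x) => by
        rw [← h1, add_comm, h2] }
  have hle : ∀ x y : S, x ≤ y ↔ x + y = y := fun _ _ => Iff.rfl
  haveI : CanonicallyOrderedAdd S :=
    { exists_add_of_le := fun {x y} h => ⟨y, ((hle x y).1 h).symm⟩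
      le_self_add := fun x y => (hle _ _).2 (by rw [← add_assoc, hid])
      le_add_self := fun x y => (hle _ _).2 (by rw [add_comm y x, ← add_assoc, hid]) }
  haveI : IsOrderedRing S :=
    { add_le_add_left := fun x y h z => (hle _ _).2 (by
        rw [add_add_add_comm, (hle x y).1 h, hid])
      zero_le_one := (hle _ _).2 (zero_add 1)
      mul_le_mul_of_nonneg_left := fun z _ x y h => (hle _ _).2 (by
        show z * x + z * y = z * y
        rw [← mul_add, (hle x y).1 h])
      mul_le_mul_of_nonneg_right := fun z _ x y h => (hle _ _).2 (by
        show x * z + y * z = y * z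
        rw [← add_mul, (hle x y).1 h]) }
  exact idem_main hid hcard A hcol b hb hbim
end

section
/- Every idempotent semifield (a division semiring satisfying 1 + 1 = 1) is left exact. -/
open Matrix

set_option linter.unusedSectionVars false

namespace IdemAux

section
variable {S : Type*} [DivisionSemiring S] [PartialOrder S] [IsOrderedAddMonoid S]
  [CanonicallyOrderedAdd S] [MulLeftMono S] [MulRightMono S]

lemma add_le_of (h : ∀ a : S, a + a = a) {a b c : S} (ha : a ≤ c) (hb : b ≤ c) : a + b ≤ c :=
  (add_le_add ha hb).trans (h c).le

lemma inv_anti' {a b : S} (ha : a ≠ 0) (hb : b ≠ 0) (hab : a ≤ b) : b⁻¹ ≤ a⁻¹ := by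
  have h1 : b⁻¹ * a * a⁻¹ ≤ b⁻¹ * b * a⁻¹ :=
    mul_le_mul_left (mul_le_mul_right hab _) _
  rwa [mul_assoc, mul_inv_cancel₀ ha, mul_one, inv_mul_cancel₀ hb, one_mul] at h1

lemma ne_zero_of_le {a b : S} (ha : a ≠ 0) (hab : a ≤ b) : b ≠ 0 := by
  rintro rfl
  exact ha (le_antisymm hab (zero_le))

lemma le_meet (h : ∀ a : S, a + a = a) {a p q : S} (hp : a ≤ p) (hq : a ≤ q) :
    a ≤ p * (p + q)⁻¹ * q := by
  by_cases ha : a = 0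
  · rw [ha]; exact zero_le
  have hp0 := ne_zero_of_le ha hp
  have hq0 := ne_zero_of_le ha hq
  have hs0 : p + q ≠ 0 := ne_zero_of_le hp0 le_self_add
  have h1 : q⁻¹ + p⁻¹ ≤ a⁻¹ := add_le_of h (inv_anti' ha hq0 hq) (inv_anti' ha hp0 hp)
  have h2 : q⁻¹ + p⁻¹ = q⁻¹ * (p + q) * p⁻¹ := by
    rw [mul_add, add_mul, mul_assoc, mul_inv_cancel₀ hp0, inv_mul_cancel₀ hq0, mul_one, one_mul]
  have h3 : q⁻¹ * (p + q) * p⁻¹ ≠ 0 := by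
    simp [hp0, hq0, hs0, -mul_eq_zero, mul_ne_zero]
  rw [h2] at h1
  have h4 := inv_anti' h3 (inv_ne_zero ha) h1
  rw [inv_inv, _root_.mul_inv_rev, _root_.mul_inv_rev, inv_inv, inv_inv, ← mul_assoc] at h4
  exact h4

lemma mul_inv_le_one {u s : S} (h : u ≤ s) : u * s⁻¹ ≤ 1 := by
  by_cases hs : s = 0
  · subst hs; simp
  · have := mul_le_mul_left h s⁻¹
    rwa [mul_inv_cancel₀ hs] at this

lemma inv_mul_le_one {u s : S} (h : u ≤ s) : s⁻¹ * u ≤ 1 := by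
  by_cases hs : s = 0
  · subst hs; simp
  · have := mul_le_mul_right h s⁻¹
    rwa [inv_mul_cancel₀ hs] at this

lemma exists_meet (h : ∀ a : S, a + a = a) (u v : S) :
    ∃ m, m ≤ u ∧ m ≤ v ∧ ∀ a w, a ≤ w + u → a ≤ w + v → a ≤ w + m := by
  refine ⟨u * (u + v)⁻¹ * v, ?_, ?_, ?_⟩
  · rw [mul_assoc]
    have := mul_le_mul_right (inv_mul_le_one (u := v) (s := u + v) le_add_self) u
    rwa [mul_one] at this
  · have := mul_le_mul_left (mul_inv_le_one (u := u) (s := u + v) le_self_add) v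
    rwa [one_mul] at this
  · intro a w hu hv
    by_cases hs : u + v = 0
    · have : u = 0 := le_antisymm (hs ▸ le_self_add) (zero_le)
      subst this
      simpa using hu
    refine (le_meet h hu hv).trans ?_
    set t := w + u + (w + v) with ht
    have hut : u ≤ t := (le_add_self : u ≤ w + u).trans le_self_add
    have hvt : w + v ≤ t := le_add_self
    have hwt : w ≤ t := (le_self_add : w ≤ w + u).trans le_self_add
    have hst : u + v ≤ t := add_le_of h hut ((le_add_self : v ≤ w + v).trans hvt)
    have ht0 : t ≠ 0 := ne_zero_of_le hs hst
    rw [add_mul, add_mul]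
    refine add_le_of h ?_ ?_
    · refine le_trans ?_ le_self_add
      rw [mul_assoc]
      have := mul_le_mul_right (inv_mul_le_one hvt) w
      rwa [mul_one] at this
    · rw [mul_add]
      refine add_le_add ?_ ?_
      · have := mul_le_mul_left (mul_inv_le_one hut) w
        rwa [one_mul] at this
      · exact mul_le_mul_left (mul_le_mul_right (inv_anti' hs ht0 hst) u) v

lemma exists_inf (h : ∀ a : S, a + a = a) {ι : Type*} (K : Finset ι) (hK : K.Nonempty)
    (u : ι → S) :
    ∃ m, (∀ k ∈ K, m ≤ u k) ∧ ∀ a w, (∀ k ∈ K, a ≤ w + u k) → a ≤ w + m := by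
  classical
  induction hK using Finset.Nonempty.cons_induction with
  | singleton k => exact ⟨u k, by simp, by simp⟩
  | cons k K hk hK ih =>
    obtain ⟨m, hm1, hm2⟩ := ih
    obtain ⟨m', h1, h2, h3⟩ := exists_meet h (u k) m
    refine ⟨m', ?_, ?_⟩
    · intro l hl
      rcases Finset.mem_cons.1 hl with rfl | hl
      · exact h1
      · exact h2.trans (hm1 l hl)
    · intro a w ha
      exact h3 a w (ha k (Finset.mem_cons_self _ _))
        (hm2 a w fun l hl => ha l (Finset.mem_cons_of_mem hl))

lemma exists_coeff (h : ∀ a : S, a + a = a) {m : ℕ} (x b : Fin m → S) :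
    ∃ c, (∀ k, x k * c ≤ b k) ∧ ∀ i, x i ≠ 0 → ∀ a w,
      (∀ k, x k ≠ 0 → a ≤ w + x i * ((x k)⁻¹ * b k)) → a ≤ w + x i * c := by
  classical
  by_cases hK : (Finset.univ.filter fun k => x k ≠ 0).Nonempty
  · obtain ⟨c, h1, h2⟩ := exists_inf h _ hK (fun k => (x k)⁻¹ * b k)
    refine ⟨c, ?_, ?_⟩
    · intro k
      by_cases hk : x k = 0
      · simp [hk]
      · have := mul_le_mul_right (h1 k (by simp [hk])) (x k)
        rwa [← mul_assoc, mul_inv_cancel₀ hk, one_mul] at this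
    · intro i hi a w ha
      have := h2 ((x i)⁻¹ * a) ((x i)⁻¹ * w) (fun k hk => by
        have := mul_le_mul_right (ha k (by simpa using hk)) (x i)⁻¹
        rwa [mul_add, ← mul_assoc _ (x i), inv_mul_cancel₀ hi, one_mul] at this)
      have := mul_le_mul_right this (x i)
      rwa [mul_add, ← mul_assoc, ← mul_assoc, mul_inv_cancel₀ hi, one_mul, one_mul] at this
  · refine ⟨0, by simp, fun i hi => ?_⟩
    exact absurd ⟨i, by simp [hi]⟩ hK

lemma main_ineq {n m : ℕ} (g : Fin m → Fin n → S) (b : Fin m → S)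
    (c : Fin n → S) (i : Fin m)
    (hc : ∀ j, g i j ≠ 0 → ∀ a w,
      (∀ k, g k j ≠ 0 → a ≤ w + g i j * ((g k j)⁻¹ * b k)) → a ≤ w + g i j * c j)
    (J : Finset (Fin n)) : ∀ w, (∀ k : Fin n → Fin m, (∀ j, g i j ≠ 0 → g (k j) j ≠ 0) →
      b i ≤ w + ∑ j ∈ J, g i j * ((g (k j) j)⁻¹ * b (k j))) →
      b i ≤ w + ∑ j ∈ J, g i j * c j := by
  classical
  induction J using Finset.induction_on with
  | empty => intro w hw; simpa using hw (fun _ => i) (fun _ h => h)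
  | insert j0 J hj ih =>
    intro w hw
    rw [Finset.sum_insert hj]
    by_cases h0 : g i j0 = 0
    · rw [h0, zero_mul, zero_add]
      refine ih w fun k hk => ?_
      have := hw k hk
      rwa [Finset.sum_insert hj, h0, zero_mul, zero_add] at this
    · rw [add_comm (g i j0 * c j0), ← add_assoc]
      refine hc j0 h0 _ _ fun k0 hk0 => ?_
      rw [add_right_comm]
      refine ih _ fun k hk => ?_
      have := hw (Function.update k j0 k0) (fun j hj => by
        by_cases hjj : j = j0
        · subst hjj; simpa using hk0
        · simpa [hjj] using hk j hj)
      rw [Finset.sum_insert hj, ← add_assoc, Function.update_self] at this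
      refine this.trans (le_of_eq ?_)
      congr 1
      refine Finset.sum_congr rfl fun j hj' => ?_
      have : j ≠ j0 := fun e => hj (e ▸ hj')
      rw [Function.update_of_ne this]

lemma exact_aux (hle : ∀ a b : S, a ≤ b ↔ a + b = b) : IsLeftExact S := by
  have h : ∀ a : S, a + a = a := fun a => (hle a a).1 le_rfl
  intro n L hL φ
  obtain ⟨m, g, rfl⟩ := Submodule.fg_iff_exists_fin_generating_family.1 hL
  have hg : ∀ i, g i ∈ Submodule.span S (Set.range g) :=
    fun i => Submodule.subset_span ⟨i, rfl⟩
  set b : Fin m → S := fun i => φ ⟨g i, hg i⟩ with hb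
  choose c hc1 hc2 using fun j => exists_coeff h (fun k => g k j) b
  have key : ∀ i, ∑ j, g i j * c j = b i := by
    intro i
    apply le_antisymm
    · have : ∀ J : Finset (Fin n), ∑ j ∈ J, g i j * c j ≤ b i := by
        classical
        intro J
        induction J using Finset.induction_on with
        | empty => simp
        | insert j J hj ih => rw [Finset.sum_insert hj]; exact add_le_of h (hc1 j i) ih
      exact this _
    · have := main_ineq g b c i (fun j => hc2 j i) Finset.univ 0 (fun k hk => ?_)
      · simpa using this
      rw [zero_add]
      set y : Submodule.span S (Set.range g) :=
        ∑ j, (g i j * (g (k j) j)⁻¹) • ⟨g (k j), hg (k j)⟩ with hy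
      have hφ : φ y = ∑ j, g i j * ((g (k j) j)⁻¹ * b (k j)) := by
        rw [hy, map_sum]
        refine Finset.sum_congr rfl fun j _ => ?_
        rw [map_smul, smul_eq_mul, mul_assoc]
      rw [← hφ, hle, hb, ← map_add]
      congr 1
      ext l
      change g i l + (y : Fin n → S) l = (y : Fin n → S) l
      rw [← hle]
      have hyl : (y : Fin n → S) l = ∑ j, (g i j * (g (k j) j)⁻¹) * g (k j) l := by
        simp [hy, Finset.sum_apply]
      rw [hyl]
      refine le_trans ?_ (Finset.single_le_sum_of_canonicallyOrdered (Finset.mem_univ l))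
      by_cases h0 : g i l = 0
      · rw [h0]; exact zero_le
      · rw [mul_assoc, inv_mul_cancel₀ (hk l h0), mul_one]
  let ψ : (Fin n → S) →ₗ[S] S :=
    { toFun := fun x => ∑ j, x j * c j
      map_add' := fun x y => by simp [add_mul, Finset.sum_add_distrib]
      map_smul' := fun r x => by simp [Finset.mul_sum, mul_assoc] }
  refine ⟨ψ, fun x hx => ?_⟩
  induction hx using Submodule.span_induction with
  | mem x hx => obtain ⟨i, rfl⟩ := hx; exact key i
  | zero => rw [map_zero]; exact (map_zero φ).symm
  | add x y hx hy ihx ihy => rw [map_add, ihx, ihy, ← map_add]; rfl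
  | smul r x hx ih => rw [map_smul, ih, ← map_smul]; rfl

end

end IdemAux

/-- Every idempotent semifield is left exact. -/
theorem idempotent_semifield_isLeftExact (S : Type*) [DivisionSemiring S]
    (hidem : (1 + 1 : S) = 1) : IsLeftExact S := by
  have h : ∀ a : S, a + a = a := fun a => by
    have := congrArg (a * ·) hidem
    simpa [mul_add] using this
  letI : PartialOrder S :=
    { le := fun a b => a + b = b
      le_refl := h
      le_trans := fun a b c (hab : a + b = b) (hbc : b + c = c) => by
        change a + c = c
        rw [← hbc, ← add_assoc, hab]
      le_antisymm := fun a b (hab : a + b = b) (hba : b + a = a) => by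
        rw [← hba, add_comm, hab] }
  have hle : ∀ a b : S, a ≤ b ↔ a + b = b := fun a b => Iff.rfl
  haveI : IsOrderedAddMonoid S :=
    { add_le_add_left := fun a b hab c => by
        rw [hle] at hab ⊢
        rw [add_add_add_comm, hab, h] }
  haveI : CanonicallyOrderedAdd S :=
    { exists_add_of_le := fun {a b} hab => ⟨b, ((hle a b).1 hab).symm⟩
      le_self_add := fun a b => by rw [hle, ← add_assoc, h]
      le_add_self := fun a b => by rw [hle, add_comm b a, ← add_assoc, h] }
  haveI : MulLeftMono S := ⟨fun a b c hbc => by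
    rw [hle] at hbc ⊢
    change a * b + a * c = a * c
    rw [← mul_add, hbc]⟩
  haveI : MulRightMono S := ⟨fun a b c hbc => by
    rw [hle] at hbc ⊢
    change b * a + c * a = c * a
    rw [← add_mul, hbc]⟩
  exact IdemAux.exact_aux hle
end

section
/- A semifield S is left exact if and only if its opposite semiring Sᵐᵒᵖ is left exact (equivalently, a semifield is left exact if and only if it is right exact). -/
open Matrix

namespace SemifieldExact

/-- The natural order of an idempotent semiring. -/
def Le {S : Type*} [Semiring S] (a b : S) : Prop := a + b = b

section order
variable {S : Type*} [Semiring S]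

theorem Le.trans {a b c : S} (h : Le a b) (h' : Le b c) : Le a c := by
  unfold Le at *
  rw [← h', ← add_assoc, h]

theorem Le.antisymm {a b : S} (h : Le a b) (h' : Le b a) : a = b := by
  unfold Le at *
  rw [← h', add_comm, h]

theorem Le.mulL {a b : S} (c : S) (h : Le a b) : Le (c * a) (c * b) := by
  unfold Le at *
  rw [← mul_add, h]

theorem Le.mulR {a b : S} (c : S) (h : Le a b) : Le (a * c) (b * c) := by
  unfold Le at *
  rw [← add_mul, h]

theorem zeroLe (a : S) : Le 0 a := by
  unfold Le
  simp

theorem Le.addLe {a b c : S} (h : Le a c) (h' : Le b c) : Le (a + b) c := by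
  unfold Le at *
  rw [add_assoc, h', h]

theorem Le.addMono {a b c d : S} (h : Le a b) (h' : Le c d) : Le (a + c) (b + d) := by
  unfold Le at *
  rw [add_add_add_comm, h, h']

theorem leRefl (hi : (1 : S) + 1 = 1) (a : S) : Le a a := by
  have := congrArg (fun t => a * t) hi
  simpa [Le, mul_add] using this

theorem leAddLeft (hi : (1 : S) + 1 = 1) (a b : S) : Le a (a + b) := by
  have := leRefl hi a
  unfold Le at *
  rw [← add_assoc, this]

theorem leAddRight (hi : (1 : S) + 1 = 1) (a b : S) : Le a (b + a) := by
  rw [add_comm]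
  exact leAddLeft hi a b

theorem sumLe {ι : Type*} (s : Finset ι) (f : ι → S) (c : S) (h : ∀ i ∈ s, Le (f i) c) :
    Le (∑ i ∈ s, f i) c := by
  classical
  induction s using Finset.induction_on with
  | empty => simpa using zeroLe c
  | insert i s hi ih =>
    rw [Finset.sum_insert hi]
    exact (h i (by simp)).addLe (ih fun k hk => h k (by simp [hk]))

theorem leSum (hi : (1 : S) + 1 = 1) {ι : Type*} (s : Finset ι) (f : ι → S) {i : ι}
    (h : i ∈ s) : Le (f i) (∑ i ∈ s, f i) := by
  classical
  rw [← Finset.add_sum_erase s f h]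
  exact leAddLeft hi _ _

end order

section division
variable {S : Type*} [DivisionSemiring S]

theorem glb_two (hi : (1 : S) + 1 = 1) (p q : S) : ∃ m : S, Le m p ∧ Le m q ∧
    ∀ R a d, Le d (R + a * p) → Le d (R + a * q) → Le d (R + a * m) := by
  by_cases hp : p = 0
  · subst hp
    exact ⟨0, zeroLe _, zeroLe _, fun R a d h _ => h⟩
  by_cases hq : q = 0
  · subst hq
    exact ⟨0, zeroLe _, zeroLe _, fun R a d _ h => h⟩
  have hne : p⁻¹ + q⁻¹ ≠ 0 := by
    intro h
    have h1 : Le p⁻¹ (p⁻¹ + q⁻¹) := leAddLeft hi _ _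
    rw [h] at h1
    have : p⁻¹ = 0 := by simpa [Le] using h1
    exact hp (by simpa using this)
  -- inverses reverse the order
  have hinv : ∀ x y : S, x ≠ 0 → y ≠ 0 → Le x y → Le y⁻¹ x⁻¹ := by
    intro x y hx hy h
    have := (h.mulL y⁻¹).mulR x⁻¹
    rwa [inv_mul_cancel₀ hy, one_mul, mul_assoc, mul_inv_cancel₀ hx, mul_one] at this
  obtain ⟨m, hm⟩ : ∃ m, m = (p⁻¹ + q⁻¹)⁻¹ := ⟨_, rfl⟩
  have hm0 : m ≠ 0 := by rw [hm]; exact inv_ne_zero hne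
  have hmp : Le m p := by
    have := hinv _ _ (inv_ne_zero hp) hne (leAddLeft hi p⁻¹ q⁻¹)
    rwa [inv_inv, ← hm] at this
  have hmq : Le m q := by
    have := hinv _ _ (inv_ne_zero hq) hne (leAddRight hi q⁻¹ p⁻¹)
    rwa [inv_inv, ← hm] at this
  have hglb : ∀ e, Le e p → Le e q → Le e m := by
    intro e h1 h2
    by_cases he : e = 0
    · subst he; exact zeroLe _
    have := hinv _ _ hne (inv_ne_zero he)
      ((hinv _ _ he hp h1).addLe (hinv _ _ he hq h2))
    rwa [inv_inv, ← hm] at this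
  -- the case a = 1
  have key : ∀ R d, Le d (R + p) → Le d (R + q) → Le d (R + m) := by
    intro R d h1 h2
    have hM : R + m ≠ 0 := by
      intro h
      have h3 : Le m (R + m) := leAddRight hi _ _
      rw [h] at h3
      exact hm0 (by simpa [Le] using h3)
    have gen : ∀ r, Le m r → Le d (R + r) → Le (d * (R + m)⁻¹ * m) r := by
      intro r hr h
      have h3 : Le (R + r) (r * m⁻¹ * (R + m)) := by
        have h4 : Le 1 (r * m⁻¹) := by
          have := hr.mulR m⁻¹
          rwa [mul_inv_cancel₀ hm0] at this
        rw [mul_add, mul_assoc r m⁻¹ m, inv_mul_cancel₀ hm0, mul_one]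
        have h5 := h4.mulR R
        rw [one_mul] at h5
        exact h5.addMono (leRefl hi r)
      have h6 := ((h.trans h3).mulR (R + m)⁻¹).mulR m
      rwa [mul_assoc (r * m⁻¹), mul_inv_cancel₀ hM, mul_one, mul_assoc r,
        inv_mul_cancel₀ hm0, mul_one] at h6
    have h7 := ((hglb _ (gen p hmp h1) (gen q hmq h2)).mulR m⁻¹).mulR (R + m)
    rwa [mul_assoc _ m, mul_inv_cancel₀ hm0, mul_one, mul_assoc d, inv_mul_cancel₀ hM,
      mul_one, one_mul] at h7
  refine ⟨m, hmp, hmq, fun R a d h1 h2 => ?_⟩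
  by_cases ha : a = 0
  · subst ha; simpa using h1
  have h3 := h1.mulL a⁻¹
  have h4 := h2.mulL a⁻¹
  rw [mul_add, ← mul_assoc a⁻¹ a, inv_mul_cancel₀ ha, one_mul] at h3 h4
  have h5 := (key _ _ h3 h4).mulL a
  rwa [mul_add, ← mul_assoc, ← mul_assoc, mul_inv_cancel₀ ha, one_mul, one_mul] at h5

theorem glb_finset (hi : (1 : S) + 1 = 1) {ι : Type*} (K : Finset ι) (hK : K.Nonempty)
    (g : ι → S) : ∃ m : S, (∀ k ∈ K, Le m (g k)) ∧
    ∀ R a d, (∀ k ∈ K, Le d (R + a * g k)) → Le d (R + a * m) := by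
  classical
  induction hK using Finset.Nonempty.cons_induction with
  | singleton k =>
    exact ⟨g k, by simpa using leRefl hi _, fun R a d h => h k (by simp)⟩
  | cons k K hk _ ih =>
    obtain ⟨m, h1, h2⟩ := ih
    obtain ⟨m', h3, h4, h5⟩ := glb_two hi (g k) m
    refine ⟨m', ?_, fun R a d h => ?_⟩
    · intro l hl
      rcases Finset.mem_cons.1 hl with rfl | hl
      · exact h3
      · exact h4.trans (h1 l hl)
    · exact h5 R a d (h k (by simp)) (h2 R a d fun l hl => h l (by simp [hl]))

theorem solve (hi : (1 : S) + 1 = 1) {ι : Type*} [Fintype ι] (n : ℕ) (A : ι → Fin n → S)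
    (c : ι → S)
    (H : ∀ (i : ι) (J : Finset (Fin n)) (x : Fin n → S) (f : Fin n → ι),
      (∀ l, Le (A i l) (∑ j ∈ J, x j * A (f j) l)) → Le (c i) (∑ j ∈ J, x j * c (f j))) :
    ∃ v : Fin n → S, ∀ i, ∑ j, A i j * v j = c i := by
  classical
  have hv : ∀ j, ∃ m : S, (∀ k, A k j ≠ 0 → Le m ((A k j)⁻¹ * c k)) ∧ ((∃ k, A k j ≠ 0) →
      ∀ R a d, (∀ k, A k j ≠ 0 → Le d (R + a * ((A k j)⁻¹ * c k))) → Le d (R + a * m)) := by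
    intro j
    by_cases h : ∃ k, A k j ≠ 0
    · obtain ⟨m, h1, h2⟩ := glb_finset hi (Finset.univ.filter fun k => A k j ≠ 0)
        (by obtain ⟨k, hk⟩ := h; exact ⟨k, by simpa using hk⟩) (fun k => (A k j)⁻¹ * c k)
      exact ⟨m, fun k hk => h1 k (by simpa using hk),
        fun _ R a d h' => h2 R a d fun k hk => h' k (by simpa using hk)⟩
    · exact ⟨0, fun k hk => zeroLe _, fun h' => absurd h' h⟩
  choose v hv1 hv2 using hv
  refine ⟨v, fun i => Le.antisymm ?_ ?_⟩
  · refine sumLe _ _ _ fun j _ => ?_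
    by_cases h : A i j = 0
    · rw [h, zero_mul]; exact zeroLe _
    · have := (hv1 j i h).mulL (A i j)
      rwa [← mul_assoc, mul_inv_cancel₀ h, one_mul] at this
  · have claim : ∀ T : Finset (Fin n), (∀ j ∈ T, A i j ≠ 0) → ∀ R,
        (∀ f : Fin n → ι, (∀ j ∈ T, A (f j) j ≠ 0) →
          Le (c i) (R + ∑ j ∈ T, A i j * ((A (f j) j)⁻¹ * c (f j)))) →
        Le (c i) (R + ∑ j ∈ T, A i j * v j) := by
      intro T
      induction T using Finset.induction_on with
      | empty =>
        intro _ R h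
        simpa using h (fun _ => i) (by simp)
      | insert j T hj ih =>
        intro hT R h
        rw [Finset.sum_insert hj, add_comm (A i j * v j), ← add_assoc]
        refine hv2 j ⟨i, hT j (by simp)⟩ _ _ _ fun k hk => ?_
        rw [add_right_comm]
        refine ih (fun l hl => hT l (by simp [hl])) _ fun f hf => ?_
        have h1 := h (Function.update f j k) (by
          intro l hl
          by_cases hlj : l = j
          · subst hlj; simpa using hk
          · rw [Function.update_of_ne hlj]
            exact hf l ((Finset.mem_insert.1 hl).resolve_left hlj))
        rw [Finset.sum_insert hj, Function.update_self, ← add_assoc] at h1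
        convert h1 using 2
        refine Finset.sum_congr rfl fun l hl => ?_
        rw [Function.update_of_ne (by rintro rfl; exact hj hl)]
    have h1 := claim (Finset.univ.filter fun j => A i j ≠ 0) (by simp) 0 (by
      intro f hf
      rw [zero_add]
      have := H i (Finset.univ.filter fun j => A i j ≠ 0)
        (fun j => A i j * (A (f j) j)⁻¹) f (by
          intro l
          by_cases hl : A i l = 0
          · rw [hl]; exact zeroLe _
          · have hl' : l ∈ Finset.univ.filter fun j => A i j ≠ 0 := by simpa using hl
            have := leSum hi _ (fun j => A i j * (A (f j) j)⁻¹ * A (f j) l) hl'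
            rwa [mul_assoc, inv_mul_cancel₀ (hf l hl'), mul_one] at this)
      simpa only [mul_assoc] using this)
    rw [zero_add] at h1
    exact h1.trans (sumLe _ _ _ fun j _ => leSum hi _ (fun j => A i j * v j) (Finset.mem_univ j))

theorem exact_of_idem (hi : (1 : S) + 1 = 1) : IsLeftExact S := by
  classical
  intro n L hL φ
  obtain ⟨s, rfl⟩ := hL
  let B : s → Submodule.span S (s : Set (Fin n → S)) :=
    fun a => ⟨a.1, Submodule.subset_span a.2⟩
  obtain ⟨v, hv⟩ := solve hi n (fun a : s => a.1) (fun a => φ (B a)) (by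
    intro i J x f h
    have h1 : B i + ∑ j ∈ J, x j • B (f j) = ∑ j ∈ J, x j • B (f j) := by
      apply Subtype.ext
      funext l
      have := h l
      simpa [Le, B, Finset.sum_apply] using this
    have h2 := congrArg φ h1
    simpa [Le, map_sum] using h2)
  let ψ : (Fin n → S) →ₗ[S] S :=
    { toFun := fun x => ∑ j, x j * v j
      map_add' := fun x y => by simp [add_mul, Finset.sum_add_distrib]
      map_smul' := fun a x => by simp [Finset.mul_sum, mul_assoc] }
  refine ⟨ψ, fun x hx => ?_⟩
  induction hx using Submodule.span_induction with
  | mem x h => exact hv ⟨x, h⟩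
  | zero => rw [map_zero]; exact (map_zero φ).symm
  | add x y hx hy h1 h2 => rw [map_add, h1, h2, ← map_add]; rfl
  | smul a x hx h1 => rw [map_smul, h1, ← map_smul]; rfl

theorem exact_of_neg (h : ∃ v : S, 1 + v = 0) : IsLeftExact S := by
  obtain ⟨v, hv⟩ := h
  let _ : Neg S := ⟨fun a => v * a⟩
  let _ : DivisionRing S :=
    { (inferInstance : DivisionSemiring S) with
      zsmul := zsmulRec
      neg_add_cancel := fun a => by
        change v * a + a = 0
        have := congrArg (· * a) hv
        simpa [add_mul, add_comm] using this
      qsmul := _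
      qsmul_def := fun _ _ => rfl
      nnqsmul := _
      nnqsmul_def := fun _ _ => rfl
      ratCast_def := fun _ => rfl
      nnratCast_def := NNRat.cast_def }
  intro n L _ φ
  obtain ⟨ψ, hψ⟩ := LinearMap.exists_extend φ
  exact ⟨ψ, fun x hx => by rw [← hψ]; rfl⟩

theorem cases_of_exact (h : IsLeftExact S) : (∃ v : S, 1 + v = 0) ∨ (1 : S) + 1 = 1 := by
  classical
  let r : Fin 2 → S := ![1, 1]
  let t : Fin 2 → S := ![1, 1 + 1]
  let L := Submodule.span S ({r, t} : Set (Fin 2 → S))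
  have hL : L.FG := ⟨{r, t}, by simp [L]⟩
  have hex : ∀ z : L, ∃ a b : S, a • r + b • t = z.1 := fun z =>
    Submodule.mem_span_pair.1 z.2
  have huniq : ∀ a b a' b' : S, a • r + b • t = a' • r + b' • t →
      a + (b + b + b) = a' + (b' + b' + b') := by
    intro a b a' b' h
    have h0 := congrFun h 0
    have h1 := congrFun h 1
    simp [r, t, mul_add] at h0 h1
    have e1 : (a + b) + b = (a + b) + b' := by
      rw [add_assoc, h1, h0, add_assoc]
    calc a + (b + b + b) = ((a + b) + b) + b := by ac_rfl
      _ = ((a + b) + b) + b' := by rw [e1, add_right_comm, e1]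
      _ = ((a' + b') + b') + b' := by rw [e1, h0]
      _ = _ := by ac_rfl
  choose α β hab using hex
  let φ : L →ₗ[S] S :=
    { toFun := fun z => α z + (β z + β z + β z)
      map_add' := fun z w => by
        have := huniq (α (z + w)) (β (z + w)) (α z + α w) (β z + β w) (by
          rw [hab, add_smul, add_smul, add_add_add_comm, hab, hab]; rfl)
        rw [this]; ac_rfl
      map_smul' := fun x z => by
        have := huniq (α (x • z)) (β (x • z)) (x * α z) (x * β z) (by
          rw [hab, mul_smul, mul_smul, ← smul_add, hab]; rfl)
        rw [this]; simp [mul_add] }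
  obtain ⟨ψ, hψ⟩ := h 2 L hL φ
  have hr : r ∈ L := Submodule.subset_span (by simp)
  have ht : t ∈ L := Submodule.subset_span (by simp)
  have er : ψ r = 1 := by
    rw [hψ r hr]
    have := huniq (α ⟨r, hr⟩) (β ⟨r, hr⟩) 1 0 (by rw [hab]; simp)
    simpa [φ] using this
  have et : ψ t = 1 + 1 + 1 := by
    rw [hψ t ht]
    have := huniq (α ⟨t, ht⟩) (β ⟨t, ht⟩) 0 1 (by rw [hab]; simp)
    simpa [φ] using this
  obtain ⟨p, hp⟩ : ∃ p, p = ψ ![1, 0] := ⟨_, rfl⟩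
  obtain ⟨q, hq⟩ : ∃ q, q = ψ ![0, 1] := ⟨_, rfl⟩
  have e1 : p + q = 1 := by
    rw [hp, hq, ← map_add]
    refine Eq.trans (congrArg ψ ?_) er
    simp [r]
  have e2 : 1 + q = 1 + 1 + 1 := by
    have e : ψ ![1, 0] + ψ ![0, 1] + ψ ![0, 1] = 1 + 1 + 1 := by
      rw [← map_add, ← map_add]
      refine Eq.trans (congrArg ψ ?_) et
      simp [t]
    rwa [← hp, ← hq, e1] at e
  -- now w = 1 + p absorbs
  have e3 : (1 + 1) + (1 + p) = (1 : S) + 1 := by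
    calc (1 + 1) + (1 + p) = (1 + 1 + 1) + p := by ac_rfl
      _ = 1 + (p + q) := by rw [← e2]; ac_rfl
      _ = 1 + 1 := by rw [e1]
  by_cases h2 : (1 : S) + 1 = 0
  · exact Or.inl ⟨1, h2⟩
  by_cases hw : 1 + p = 0
  · exact Or.inl ⟨p, hw⟩
  right
  have e4 : 1 + (1 + p) = 1 := by
    have h5 : (1 + 1) * (1 + (1 + p)) = ((1 : S) + 1) * 1 := by
      rw [mul_one]
      calc (1 + 1) * (1 + (1 + p)) = ((1 + 1) + (1 + p)) + (1 + p) := by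
            rw [mul_add, mul_one, add_mul, one_mul]; ac_rfl
        _ = 1 + 1 := by rw [e3, e3]
    exact mul_left_cancel₀ h2 h5
  have e5 : (1 + p) + (1 + p) = 1 + p := by
    calc (1 + p) + (1 + p) = (1 + (1 + p)) + p := by ac_rfl
      _ = 1 + p := by rw [e4]
  apply mul_left_cancel₀ hw
  rw [mul_add, mul_one, e5]

theorem exact_iff : IsLeftExact S ↔ (∃ v : S, 1 + v = 0) ∨ (1 : S) + 1 = 1 :=
  ⟨cases_of_exact, fun h => h.elim exact_of_neg exact_of_idem⟩

end division

end SemifieldExact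

/-- A semifield is left exact iff its opposite semiring is left exact, i.e., a semifield is
left exact iff it is right exact. -/
theorem semifield_isLeftExact_iff_op (S : Type*) [DivisionSemiring S] :
    IsLeftExact S ↔ IsLeftExact Sᵐᵒᵖ := by
  rw [SemifieldExact.exact_iff, SemifieldExact.exact_iff]
  refine or_congr ⟨?_, ?_⟩ ⟨?_, ?_⟩
  · rintro ⟨v, hv⟩
    exact ⟨MulOpposite.op v, MulOpposite.unop_injective (by simpa using hv)⟩
  · rintro ⟨v, hv⟩
    exact ⟨MulOpposite.unop v, by simpa using congrArg MulOpposite.unop hv⟩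
  · intro h
    exact MulOpposite.unop_injective (by simpa using h)
  · intro h
    simpa using congrArg MulOpposite.unop h
end

section
/- The tropical semiring 𝕋 = (ℝ ∪ {∞}, min, +), formalized as Tropical (WithTop ℝ), is left exact. -/
open Matrix

theorem trop_exists_inv (x : Tropical (WithTop ℝ)) (hx : x ≠ 0) :
    ∃ y : Tropical (WithTop ℝ), y * x = 1 := by
  induction x using Tropical.tropRec with
  | h x =>
    induction x using WithTop.recTopCoe with
    | top => exact absurd rfl hx
    | coe r =>
      refine ⟨Tropical.trop ((-r : ℝ) : WithTop ℝ), ?_⟩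
      rw [← Tropical.trop_add, ← WithTop.coe_add]
      simp

theorem trop_add_self' (x : Tropical (WithTop ℝ)) : x + x = x := by
  simp

/-- Choice of the coefficient on one coordinate (residuation). -/
theorem trop_coeff {ι : Type*} (s : Finset ι) (f g : ι → Tropical (WithTop ℝ)) :
    ∃ a : Tropical (WithTop ℝ), (∀ j ∈ s, f j + a * g j = f j) ∧
      ((∀ j ∈ s, g j = 0) ∨ ∃ j ∈ s, g j ≠ 0 ∧ a * g j = f j) := by
  classical
  have hinv : ∀ x : Tropical (WithTop ℝ), ∃ y, x ≠ 0 → y * x = 1 := by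
    intro x
    by_cases hx : x = 0
    · exact ⟨0, fun h => absurd hx h⟩
    · obtain ⟨y, hy⟩ := trop_exists_inv x hx
      exact ⟨y, fun _ => hy⟩
  choose inv hinv using hinv
  rcases (s.filter (fun j => g j ≠ 0)).eq_empty_or_nonempty with h | h
  · refine ⟨0, fun j _ => by simp, Or.inl fun j hj => ?_⟩
    by_contra hne
    have : j ∈ s.filter (fun j => g j ≠ 0) := by simp [hj, hne]
    simp [h] at this
  · obtain ⟨j, hj, hmax⟩ := Finset.exists_max_image _ (fun j => f j * inv (g j)) h
    rw [Finset.mem_filter] at hj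
    refine ⟨f j * inv (g j), fun k hk => ?_, Or.inr ⟨j, hj.1, hj.2, ?_⟩⟩
    · by_cases hk0 : g k = 0
      · simp [hk0]
      · have h1 := hmax k (by simp [hk, hk0])
        have h2 := Tropical.add_eq_left h1
        calc f k + f j * inv (g j) * g k
            = f k * (inv (g k) * g k) + f j * inv (g j) * g k := by rw [hinv _ hk0, mul_one]
          _ = (f k * inv (g k) + f j * inv (g j)) * g k := by ring
          _ = f k * (inv (g k) * g k) := by rw [h2]; ring
          _ = f k := by rw [hinv _ hk0, mul_one]
    · rw [mul_assoc, hinv _ hj.2, mul_one]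

/-- The tropical semiring `𝕋 = (ℝ ∪ {∞}, min, +)` is left exact. -/
theorem tropical_isLeftExact : IsLeftExact (Tropical (WithTop ℝ)) := by
  classical
  intro n L hL φ
  obtain ⟨s, rfl⟩ := hL
  have hs : ∀ x ∈ s, x ∈ Submodule.span (Tropical (WithTop ℝ)) (s : Set (Fin n → Tropical (WithTop ℝ))) :=
    fun x hx => Submodule.subset_span hx
  have key := fun i : Fin n => trop_coeff s.attach (fun j => φ ⟨j.1, hs _ j.2⟩) (fun j => j.1 i)
  choose a ha1 ha2 using key
  let ψ : (Fin n → Tropical (WithTop ℝ)) →ₗ[Tropical (WithTop ℝ)] Tropical (WithTop ℝ) :=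
    { toFun := fun x => ∑ i, a i * x i
      map_add' := fun x y => by simp [mul_add, Finset.sum_add_distrib]
      map_smul' := fun c x => by
        simp only [Pi.smul_apply, smul_eq_mul, RingHom.id_apply, Finset.mul_sum]
        exact Finset.sum_congr rfl fun i _ => by ring }
  have hgen : ∀ k (hk : k ∈ s), ψ k = φ ⟨k, hs k hk⟩ := by
    intro k hk
    have h1 : φ ⟨k, hs k hk⟩ + ψ k = φ ⟨k, hs k hk⟩ := by
      change _ + ∑ i, a i * k i = _
      have : ∀ t : Finset (Fin n), φ ⟨k, hs k hk⟩ + ∑ i ∈ t, a i * k i = φ ⟨k, hs k hk⟩ := by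
        intro t
        induction t using Finset.induction_on with
        | empty => simp
        | insert i t hi ih =>
          rw [Finset.sum_insert hi, ← add_assoc, ha1 i ⟨k, hk⟩ (Finset.mem_attach _ _), ih]
      exact this _
    have hy : ∀ i, ∃ y : Submodule.span (Tropical (WithTop ℝ)) (s : Set (Fin n → Tropical (WithTop ℝ))),
        y.1 i = k i ∧ φ y = a i * k i := by
      intro i
      rcases ha2 i with h | ⟨j, _, hj0, hj⟩
      · have := h ⟨k, hk⟩ (Finset.mem_attach _ _)
        refine ⟨0, ?_, ?_⟩ <;> simp_all
      · obtain ⟨v, hv⟩ := trop_exists_inv _ hj0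
        refine ⟨(k i * v) • ⟨j.1, hs _ j.2⟩, ?_, ?_⟩
        · change k i * v * j.1 i = k i
          rw [mul_assoc, hv, mul_one]
        · rw [map_smul, smul_eq_mul, ← hj]
          calc k i * v * (a i * j.1 i) = a i * k i * (v * j.1 i) := by ring
            _ = _ := by rw [hv, mul_one]
    choose y hy1 hy2 using hy
    have h2 : (∑ i, y i) + ⟨k, hs k hk⟩ = ∑ i, y i := by
      apply Subtype.ext
      funext i
      have e : ((∑ i, y i : Submodule.span (Tropical (WithTop ℝ)) (s : Set (Fin n → Tropical (WithTop ℝ)))) : Fin n → Tropical (WithTop ℝ)) i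
          = k i + ∑ i' ∈ Finset.univ.erase i, (y i').1 i := by
        rw [← hy1 i, Finset.add_sum_erase _ (fun i' => (y i').1 i) (Finset.mem_univ i)]
        simp
      change _ + k i = _
      rw [e, add_right_comm, trop_add_self']
    have h3 := congrArg φ h2
    rw [map_add, map_sum, Finset.sum_congr rfl fun i _ => hy2 i] at h3
    change ψ k + _ = ψ k at h3
    rw [← h3, add_comm, h1]
  refine ⟨ψ, fun x hx => ?_⟩
  induction hx using Submodule.span_induction with
  | mem x h => exact hgen x h
  | zero => rw [map_zero]; exact (map_zero φ).symm
  | add x y hx hy ihx ihy => rw [map_add, ihx, ihy, ← map_add]; rfl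
  | smul c x hx ih => rw [map_smul, ih, ← map_smul]; rfl
end
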